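/- Let G be a strongly connected Eulerian digraph and let d⁻ be its indegree vector. Then for every chip-distribution x on G, minfas(G) − deg(x) ≤ dist(x) − dist(d⁻ − x) ≤ |E(G)| − minfas(G) − deg(x), where |E(G)| is the total number of directed edges. -/

import Mathlib

open Finset

variable {V : Type} [Fintype V] [DecidableEq V]

/-- The outdegree of a vertex `v` in the multidigraph with multiplicity function `m`
(`m u v` is the number of directed edges from `u` to `v`). -/
def outdeg (m : V → V → ℕ) (v : V) : ℤ := ∑ u, (m v u : ℤ)

/-- The indegree of a vertex. -/
def indeg (m : V → V → ℕ) (v : V) : ℤ := ∑ u, (m u v : ℤ)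

/-- The digraph is loopless. -/
def Loopless (m : V → V → ℕ) : Prop := ∀ v, m v v = 0

/-- The digraph is strongly connected: every vertex reaches every vertex on a directed path. -/
def StronglyConnected (m : V → V → ℕ) : Prop :=
  ∀ u v : V, Relation.ReflTransGen (fun a b => 0 < m a b) u v

/-- Firing vertex `v` in chip-distribution `x`: `v` sends a chip along each outgoing edge. -/
def fire (m : V → V → ℕ) (x : V → ℤ) (v : V) : V → ℤ :=
  fun u => x u + (m v u : ℤ) - (if u = v then outdeg m v else 0)

/-- The degree (total number of chips) of a chip-distribution / divisor. -/
def degSum (x : V → ℤ) : ℤ := ∑ v, x v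

/-- The state of the chip-firing game after `n` steps, starting from `x` and
firing the vertices `s 0, s 1, …` in this order. -/
def gameState (m : V → V → ℕ) (x : V → ℤ) (s : ℕ → V) : ℕ → (V → ℤ)
  | 0 => x
  | n + 1 => fire m (gameState m x s n) (s n)

/-- `s` encodes an infinite legal chip-firing game starting from `x`:
at each step the fired vertex is active. -/
def InfGame (m : V → V → ℕ) (x : V → ℤ) (s : ℕ → V) : Prop :=
  ∀ n, outdeg m (s n) ≤ gameState m x s n (s n)

/-- A chip-distribution is terminating if no infinite legal game starts from it. -/
def Terminating (m : V → V → ℕ) (x : V → ℤ) : Prop :=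
  ¬ ∃ s : ℕ → V, InfGame m x s

/-- The Laplacian of the digraph applied to `z`. -/
def lap (m : V → V → ℕ) (z : V → ℤ) : V → ℤ :=
  fun u => (∑ v, (m v u : ℤ) * z v) - outdeg m u * z u

/-- Linear equivalence: `x ∼ y` iff `x = y + L z` for some integer vector `z`. -/
def LinEquiv (m : V → V → ℕ) (x y : V → ℤ) : Prop :=
  ∃ z : V → ℤ, x = y + lap m z

/-- The distance of `x` from the non-terminating distributions:
the minimum degree of a nonnegative `y` such that `x + y` is non-terminating. -/
noncomputable def chipDist (m : V → V → ℕ) (x : V → ℤ) : ℕ :=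
  sInf {n : ℕ | ∃ y : V → ℤ, 0 ≤ y ∧ degSum y = (n : ℤ) ∧ ¬ Terminating m (x + y)}

/-- A multidigraph (given by its multiplicity function) is acyclic if it has no directed cycle,
i.e. no vertex can reach itself by a directed walk of positive length. -/
def AcyclicMul (k : V → V → ℕ) : Prop :=
  ∀ v : V, ¬ Relation.TransGen (fun a b => 0 < k a b) v v

/-- The minimum cardinality of a feedback arc set. -/
noncomputable def minfas (m : V → V → ℕ) : ℕ :=
  sInf {n : ℕ | ∃ F : V → V → ℕ, (∀ u v, F u v ≤ m u v) ∧
    AcyclicMul (fun u v => m u v - F u v) ∧ ∑ u, ∑ v, F u v = n}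

/-- The number of edges into `v` coming from vertices that `σ` places after `v`. -/
def laterIndeg (m : V → V → ℕ) (σ : V → ℤ) (v : V) : ℤ :=
  ∑ u, if σ v < σ u then (m u v : ℤ) else 0

theorem degSum_lap {V : Type} [Fintype V] (m : V → V → ℕ) (z : V → ℤ) : degSum (lap m z) = 0 := by
  unfold degSum lap outdeg
  rw [sum_sub_distrib, sum_comm]
  simp [sum_mul]

theorem degSum_add {V : Type} [Fintype V] (x y : V → ℤ) : degSum (x + y) = degSum x + degSum y := by
  simp [degSum, sum_add_distrib]

theorem degSum_sub {V : Type} [Fintype V] (x y : V → ℤ) : degSum (x - y) = degSum x - degSum y := by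
  simp [degSum, sum_sub_distrib]

theorem fire_add_lap (m : V → V → ℕ) (x c : V → ℤ) (v : V) :
    fire m (x + lap m c) v = x + lap m (c + Pi.single v 1) := by
  funext u
  by_cases h : u = v
  · subst h
    simp [fire, lap, mul_add, sum_add_distrib, Pi.single_apply]
    ring
  · simp [fire, lap, mul_add, sum_add_distrib, Pi.single_apply, h]
    ring

theorem exists_gameState_eq_add_lap (m : V → V → ℕ) (x : V → ℤ) (s : ℕ → V) (n : ℕ) :
    ∃ c, gameState m x s n = x + lap m c := by
  induction n with
  | zero => exact ⟨0, by funext u; simp [gameState, lap]⟩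
  | succ n ih =>
    obtain ⟨c, hc⟩ := ih
    exact ⟨_, by rw [gameState, hc, fire_add_lap]⟩

theorem laterIndeg_add_laterIndeg_neg {m : V → V → ℕ} (hloop : Loopless m) {σ : V → ℤ}
    (hσ : Function.Injective σ) (v : V) :
    laterIndeg m σ v + laterIndeg m (-σ) v = indeg m v := by
  unfold laterIndeg indeg
  rw [← sum_add_distrib]
  refine sum_congr rfl fun u _ => ?_
  by_cases h : u = v
  · subst h; simp [hloop u]
  · have := hσ.ne h
    rcases lt_or_gt_of_ne this with h | h
    · simp [h, h.le]
    · simp [h, h.le]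

theorem minfas_le_degSum_laterIndeg {V : Type} [Fintype V] {m : V → V → ℕ}
    (hloop : Loopless m) {σ : V → ℤ}
    (hσ : Function.Injective σ) : (minfas m : ℤ) ≤ degSum (laterIndeg m σ) := by
  have h : minfas m ≤ ∑ u, ∑ v, if σ v < σ u then m u v else 0 := by
    refine Nat.sInf_le ⟨fun u v => if σ v < σ u then m u v else 0, fun u v => ?_,
      fun v hv => ?_, rfl⟩
    · dsimp only
      split_ifs <;> simp
    · have key : ∀ a b, Relation.TransGen
          (fun u v => 0 < m u v - if σ v < σ u then m u v else 0) a b → σ a < σ b := by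
        have step : ∀ a b, (0 < m a b - if σ b < σ a then m a b else 0) → σ a < σ b := by
          intro a b hab
          split_ifs at hab with hlt
          · simp at hab
          · refine lt_of_le_of_ne (not_lt.1 hlt) fun he => ?_
            have := hσ he
            subst this
            simp [hloop a] at hab
        intro a b hab
        induction hab with
        | single h => exact step _ _ h
        | tail _ h ih => exact ih.trans (step _ _ h)
      exact lt_irrefl _ (key v v hv)
  rw [sum_comm] at h
  unfold degSum laterIndeg
  exact_mod_cast h

/-- The vertex that is least for `c`, with ties broken by `σ`, is active. -/
theorem exists_active [Nonempty V] {m : V → V → ℕ} (hloop : Loopless m)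
    (heul : ∀ v, outdeg m v = indeg m v) {σ : V → ℤ} (hσ : Function.Injective σ)
    {y : V → ℤ} (hy : laterIndeg m σ ≤ y) (c : V → ℤ) :
    ∃ v, outdeg m v ≤ (y + lap m c) v := by
  obtain ⟨v, hv⟩ := Finite.exists_min fun v => toLex (c v, σ v)
  refine ⟨v, ?_⟩
  have h1 : lap m c v = ∑ u, (m u v : ℤ) * (c u - c v) := by
    simp [lap, heul, indeg, mul_sub, sum_mul]
  have h2 : laterIndeg m (-σ) v ≤ lap m c v := by
    rw [h1]
    refine sum_le_sum fun u _ => ?_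
    have hu := Prod.Lex.toLex_le_toLex.1 (hv u)
    simp only at hu
    have hm : (0 : ℤ) ≤ m u v := by positivity
    split_ifs with h
    · have h' : σ u < σ v := by simpa using h
      have : 1 ≤ c u - c v := by omega
      nlinarith
    · have : 0 ≤ c u - c v := by omega
      positivity
  have h3 := laterIndeg_add_laterIndeg_neg hloop hσ v
  have h4 : laterIndeg m σ v ≤ y v := hy v
  rw [heul, Pi.add_apply]
  omega

theorem not_terminating_of_laterIndeg_le [Nonempty V] {m : V → V → ℕ} (hloop : Loopless m)
    (heul : ∀ v, outdeg m v = indeg m v) {σ : V → ℤ} (hσ : Function.Injective σ)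
    {y : V → ℤ} (hy : laterIndeg m σ ≤ y) (z : V → ℤ) :
    ¬ Terminating m (y + lap m z) := by
  choose g hg using exists_active hloop heul hσ hy
  let c : ℕ → V → ℤ := fun n => Nat.rec z (fun _ d => d + Pi.single (g d) 1) n
  have hstate : ∀ n, gameState m (y + lap m z) (fun n => g (c n)) n = y + lap m (c n) := by
    intro n
    induction n with
    | zero => rfl
    | succ n ih => rw [gameState, ih, fire_add_lap]
  refine not_not.2 ⟨fun n => g (c n), fun n => ?_⟩
  rw [hstate]
  exact hg _

theorem min_le_gameState {m : V → V → ℕ} {x : V → ℤ} {s : ℕ → V} (hs : InfGame m x s)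
    (n : ℕ) (v : V) : min (x v) 0 ≤ gameState m x s n v := by
  induction n with
  | zero => exact min_le_left _ _
  | succ n ih =>
    have hn := hs n
    simp only [gameState, fire]
    have hm : (0 : ℤ) ≤ m (s n) v := by positivity
    split_ifs with h
    · subst h; omega
    · omega

theorem gameState_le {m : V → V → ℕ} {x : V → ℤ} {s : ℕ → V} (hs : InfGame m x s)
    (n : ℕ) (v : V) :
    gameState m x s n v ≤ degSum x - degSum (fun u => min (x u) 0) + min (x v) 0 := by
  obtain ⟨c, hc⟩ := exists_gameState_eq_add_lap m x s n
  have h1 : degSum (gameState m x s n) = degSum x := by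
    rw [hc, degSum_add, degSum_lap, add_zero]
  have h2 := single_le_sum (f := fun u => gameState m x s n u - min (x u) 0)
    (fun u _ => sub_nonneg.2 (min_le_gameState hs n u)) (mem_univ v)
  rw [sum_sub_distrib] at h2
  unfold degSum at *
  linarith

theorem fires_infinitely_often_of_edge {m : V → V → ℕ} {x : V → ℤ} {s : ℕ → V}
    (hs : InfGame m x s) {u v : V} (huv : 0 < m u v) (hu : ∀ N, ∃ n ≥ N, s n = u) :
    ∀ N, ∃ n ≥ N, s n = v := by
  by_contra! ⟨N, hN⟩
  have hstep : ∀ n ≥ N, gameState m x s (n + 1) v = gameState m x s n v + m (s n) v := by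
    intro n hn
    simp [gameState, fire, (hN n hn).symm]
  have hmono : ∀ k, ∀ n ≥ N, gameState m x s n v ≤ gameState m x s (n + k) v := by
    intro k n hn
    induction k with
    | zero => simp
    | succ k ih =>
      have := hstep (n + k) (by omega)
      rw [← add_assoc, this]
      omega
  have hgrow : ∀ k : ℕ, ∃ n ≥ N, gameState m x s N v + k ≤ gameState m x s n v := by
    intro k
    induction k with
    | zero => exact ⟨N, le_rfl, by simp⟩
    | succ k ih =>
      obtain ⟨n, hn, hle⟩ := ih
      obtain ⟨p, hp, rfl⟩ := hu n
      obtain ⟨j, rfl⟩ := Nat.exists_eq_add_of_le hp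
      have h1 := hmono j n hn
      have h2 := hstep (n + j) (by omega)
      refine ⟨n + j + 1, by omega, ?_⟩
      push_cast
      omega
  obtain ⟨n, -, hn⟩ := hgrow (degSum x - degSum (fun u => min (x u) 0) + min (x v) 0
    - gameState m x s N v + 1).toNat
  have := gameState_le hs n v
  omega

theorem fires_infinitely_often {m : V → V → ℕ} (hconn : StronglyConnected m) {x : V → ℤ}
    {s : ℕ → V} (hs : InfGame m x s) (v : V) : ∀ N, ∃ n ≥ N, s n = v := by
  obtain ⟨u, hu⟩ := Finite.exists_infinite_fiber s
  have hu' : ∀ N, ∃ n ≥ N, s n = u := by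
    intro N
    obtain ⟨n, hn, hlt⟩ := (Set.infinite_coe_iff.1 hu).exists_gt N
    exact ⟨n, hlt.le, hn⟩
  induction hconn u v with
  | refl => exact hu'
  | tail _ h ih => exact fires_infinitely_often_of_edge hs h ih

/-- One plus the last time before `n` at which each vertex was fired, and `0` for the vertices
that were not fired. -/
def lastFired (s : ℕ → V) : ℕ → V → ℤ
  | 0 => 0
  | n + 1 => Function.update (lastFired s n) (s n) (n + 1)

theorem lastFired_le {V : Type} [DecidableEq V] (s : ℕ → V) (n : ℕ) (v : V) :
    lastFired s n v ≤ n := by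
  induction n with
  | zero => simp [lastFired]
  | succ n ih =>
    simp only [lastFired, Function.update_apply]
    split_ifs <;> push_cast <;> omega

theorem lastFired_pos {V : Type} [DecidableEq V] {s : ℕ → V} {k n : ℕ} (h : k < n) :
    0 < lastFired s n (s k) := by
  induction n with
  | zero => omega
  | succ n ih =>
    simp only [lastFired, Function.update_apply]
    split_ifs with he
    · omega
    · refine ih (lt_of_le_of_ne (by omega) ?_)
      rintro rfl
      exact he rfl

theorem eq_of_lastFired_eq {V : Type} [DecidableEq V] {s : ℕ → V} {n : ℕ} {u v : V}
    (hu : 0 < lastFired s n u)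
    (h : lastFired s n u = lastFired s n v) : u = v := by
  induction n with
  | zero => simp [lastFired] at hu
  | succ n ih =>
    have h1 := lastFired_le s n u
    have h2 := lastFired_le s n v
    simp only [lastFired, Function.update_apply] at hu h
    split_ifs at hu h with ha hb hb
    · rw [ha, hb]
    · omega
    · omega
    · exact ih hu h

theorem laterIndeg_lastFired_le {m : V → V → ℕ} {x : V → ℤ} {s : ℕ → V} (hs : InfGame m x s)
    (n : ℕ) (v : V) (hv : 0 < lastFired s n v) :
    laterIndeg m (lastFired s n) v ≤ gameState m x s n v := by
  induction n with
  | zero => simp [lastFired] at hv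
  | succ n ih =>
    by_cases h : v = s n
    · have h0 : laterIndeg m (lastFired s (n + 1)) v = 0 := by
        refine sum_eq_zero fun u _ => if_neg ?_
        have := lastFired_le s (n + 1) u
        simp only [lastFired, h, Function.update_self] at this ⊢
        push_cast at this
        omega
      have hn := hs n
      rw [h0, gameState, fire, if_pos h, h]
      have hm : (0 : ℤ) ≤ m (s n) (s n) := by positivity
      omega
    · have hv' : lastFired s (n + 1) v = lastFired s n v := by simp [lastFired, h]
      have h1 : laterIndeg m (lastFired s (n + 1)) v
          ≤ laterIndeg m (lastFired s n) v + m (s n) v := by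
        have : (m (s n) v : ℤ) = ∑ u, if u = s n then (m u v : ℤ) else 0 := by simp
        unfold laterIndeg
        rw [this, ← sum_add_distrib]
        refine sum_le_sum fun u _ => ?_
        have hm : (0 : ℤ) ≤ m u v := by positivity
        rw [hv']
        by_cases hu : u = s n
        · simp only [if_pos hu]
          split_ifs <;> omega
        · have : lastFired s (n + 1) u = lastFired s n u := by simp [lastFired, hu]
          rw [this, if_neg hu, add_zero]
      have h2 := ih (hv' ▸ hv)
      rw [gameState, fire, if_neg h]
      omega

theorem exists_laterIndeg_le_of_not_terminating {m : V → V → ℕ} (hconn : StronglyConnected m)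
    {x : V → ℤ} (hx : ¬ Terminating m x) :
    ∃ (σ : V → ℤ) (c : V → ℤ), Function.Injective σ ∧ laterIndeg m σ ≤ x + lap m c := by
  obtain ⟨s, hs⟩ := not_not.1 hx
  choose t _ ht using fun v => fires_infinitely_often hconn hs v 0
  obtain ⟨T, hT⟩ := (Set.finite_range t).bddAbove
  have hpos : ∀ v, 0 < lastFired s (T + 1) v := fun v => by
    simpa [ht] using lastFired_pos (s := s) (Nat.lt_succ_of_le (hT ⟨v, rfl⟩))
  obtain ⟨c, hc⟩ := exists_gameState_eq_add_lap m x s (T + 1)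
  refine ⟨lastFired s (T + 1), c, fun u v h => eq_of_lastFired_eq (hpos u) h, fun v => ?_⟩
  rw [← hc]
  exact laterIndeg_lastFired_le hs _ v (hpos v)

theorem exists_chipDist_eq [Nonempty V] {m : V → V → ℕ} (hloop : Loopless m)
    (heul : ∀ v, outdeg m v = indeg m v) (x : V → ℤ) :
    ∃ y : V → ℤ, 0 ≤ y ∧ degSum y = (chipDist m x : ℤ) ∧ ¬ Terminating m (x + y) := by
  refine Nat.sInf_mem (s := {n : ℕ | ∃ y : V → ℤ, 0 ≤ y ∧ degSum y = (n : ℤ) ∧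
    ¬ Terminating m (x + y)}) ?_
  let σ : V → ℤ := fun v => (Fintype.equivFin V v : ℕ)
  have hσ : Function.Injective σ := fun u v h => by simpa [σ, Fin.val_inj] using h
  let y : V → ℤ := fun v => max (laterIndeg m σ v - x v) 0
  have hy : 0 ≤ y := fun v => le_max_right _ _
  have hle : laterIndeg m σ ≤ x + y := fun v => by
    have : laterIndeg m σ v - x v ≤ y v := le_max_left _ _
    simp only [Pi.add_apply]
    omega
  refine ⟨(degSum y).toNat, y, hy, (Int.toNat_of_nonneg (sum_nonneg fun v _ => hy v)).symm, ?_⟩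
  have hlap : lap m 0 = 0 := by funext u; simp [lap]
  simpa [hlap] using not_terminating_of_laterIndeg_le hloop heul hσ hle 0

theorem chipDist_le_of_not_terminating {m : V → V → ℕ} {x y : V → ℤ} (hy : 0 ≤ y)
    (h : ¬ Terminating m (x + y)) : (chipDist m x : ℤ) ≤ degSum y := by
  have h0 : 0 ≤ degSum y := sum_nonneg fun v _ => hy v
  have : chipDist m x ≤ (degSum y).toNat :=
    Nat.sInf_le ⟨y, hy, (Int.toNat_of_nonneg h0).symm, h⟩
  omega

theorem minfas_add_chipDist_le [Nonempty V] {m : V → V → ℕ} (hloop : Loopless m)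
    (hconn : StronglyConnected m) (heul : ∀ v, outdeg m v = indeg m v) (x : V → ℤ) :
    (minfas m : ℤ) + chipDist m (fun v => indeg m v - x v) ≤ chipDist m x + degSum x := by
  obtain ⟨y, hy, hdeg, hnt⟩ := exists_chipDist_eq hloop heul x
  obtain ⟨σ, c, hσ, hle⟩ := exists_laterIndeg_le_of_not_terminating hconn hnt
  have hmin := minfas_le_degSum_laterIndeg hloop hσ
  have heq : (fun v => indeg m v - x v) + (x + y + lap m c - laterIndeg m σ)
      = (laterIndeg m (-σ) + y) + lap m c := by
    funext v
    have := laterIndeg_add_laterIndeg_neg hloop hσ v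
    simp only [Pi.add_apply, Pi.sub_apply]
    omega
  have hd := chipDist_le_of_not_terminating (m := m) (x := fun v => indeg m v - x v)
    (sub_nonneg.2 hle) (by
      rw [heq]
      exact not_terminating_of_laterIndeg_le hloop heul (neg_injective.comp hσ)
        (le_add_of_nonneg_right hy) c)
  rw [degSum_sub, degSum_add, degSum_add, degSum_lap] at hd
  omega

/-- **Weak Riemann–Roch theorem for Eulerian digraphs**: for every chip-distribution `x`
on a strongly connected Eulerian digraph,
`minfas(G) - deg(x) ≤ dist(x) - dist(d⁻ - x) ≤ |E(G)| - minfas(G) - deg(x)`. -/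
theorem weak_riemann_roch_eulerian
    {V : Type} [Fintype V] [DecidableEq V] [Nonempty V]
    (m : V → V → ℕ) (hloop : Loopless m) (hconn : StronglyConnected m)
    (heul : ∀ v, outdeg m v = indeg m v)
    (x : V → ℤ) :
    (minfas m : ℤ) - degSum x
        ≤ (chipDist m x : ℤ) - (chipDist m (fun v => indeg m v - x v) : ℤ) ∧
      (chipDist m x : ℤ) - (chipDist m (fun v => indeg m v - x v) : ℤ)
        ≤ (∑ u, ∑ v, (m u v : ℤ)) - (minfas m : ℤ) - degSum x := by
  have h1 := minfas_add_chipDist_le hloop hconn heul x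
  have h2 := minfas_add_chipDist_le hloop hconn heul (fun v => indeg m v - x v)
  have hE : degSum (fun v => indeg m v - x v) = (∑ u, ∑ v, (m u v : ℤ)) - degSum x := by
    rw [sum_comm]
    simp [degSum, indeg, sum_sub_distrib]
  simp only [sub_sub_cancel] at h2
  rw [hE] at h2
  constructor <;> linarith
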